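/- arXiv:2109.14999 — 2 statements merged into one kernel-verified Lean document; each statement's English description precedes it below -/
import Mathlib

section
/- Let α, β > −1, N ≥ 1, let −1 < z_{1,N} < ... < z_{N,N} < 1 be the ordered roots of the Jacobi polynomial P_N^{(α,β)}, and let M = max_{j=1,...,N} 2j(2N + α + β + 1 − j). Then for every i ∈ {1,...,N}, ( 4 Σ_{l ≠ i} (1 − z_{i,N}²)/(z_{i,N} − z_{l,N})² + 2(α+1)(1 + z_{i,N})/(1 − z_{i,N}) + 2(β+1)(1 − z_{i,N})/(1 + z_{i,N}) )² + 16 Σ_{l ≠ i} (1 − z_{l,N}²)(1 − z_{i,N}²)/(z_{i,N} − z_{l,N})⁴ ≤ M². -/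
/-- The Jacobi polynomials `P_n^{(a,b)}`, orthogonal w.r.t. the weight
`(1-x)^a·(1+x)^b` on `(-1,1)` (for `a, b > -1`), defined via the standard
three-term recurrence
`P_0 = 1`, `P_1 = (a-b)/2 + ((a+b+2)/2)·X`, and for `n ≥ 2`:
`2n(n+a+b)(2n+a+b-2)·P_n
  = (2n+a+b-1)·[(2n+a+b)(2n+a+b-2)·X + a²-b²]·P_{n-1}
    - 2(n+a-1)(n+b-1)(2n+a+b)·P_{n-2}`. -/
noncomputable def jacobiP (a b : ℝ) : ℕ → Polynomial ℝ
  | 0 => 1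
  | 1 => Polynomial.C ((a - b) / 2) + Polynomial.C ((a + b + 2) / 2) * Polynomial.X
  | n + 2 =>
      Polynomial.C
          (1 / (2 * ((n : ℝ) + 2) * (((n : ℝ) + 2) + a + b)
            * (2 * ((n : ℝ) + 2) + a + b - 2))) *
        (Polynomial.C (2 * ((n : ℝ) + 2) + a + b - 1) *
            ((Polynomial.C ((2 * ((n : ℝ) + 2) + a + b)
                * (2 * ((n : ℝ) + 2) + a + b - 2)) * Polynomial.X
              + Polynomial.C (a ^ 2 - b ^ 2)) * jacobiP a b (n + 1))
          - Polynomial.C (2 * (((n : ℝ) + 2) + a - 1) * (((n : ℝ) + 2) + b - 1)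
              * (2 * ((n : ℝ) + 2) + a + b)) * jacobiP a b n)

open Polynomial

theorem jacobiP_recurrence {a b : ℝ} (ha : -1 < a) (hb : -1 < b) (n : ℕ) :
    C (2 * ((n : ℝ) + 2) * ((n : ℝ) + 2 + a + b) * (2 * (n : ℝ) + 2 + a + b)) *
        jacobiP a b (n + 2) =
      C (2 * (n : ℝ) + 3 + a + b) *
          (C ((2 * (n : ℝ) + 4 + a + b) * (2 * (n : ℝ) + 2 + a + b)) * X + C (a ^ 2 - b ^ 2)) *
          jacobiP a b (n + 1) -
        C (2 * ((n : ℝ) + 1 + a) * ((n : ℝ) + 1 + b) * (2 * (n : ℝ) + 4 + a + b)) *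
          jacobiP a b n := by
  have hn : (0 : ℝ) ≤ n := n.cast_nonneg
  rw [jacobiP, ← mul_assoc, ← C_mul]
  have hK : 2 * ((n : ℝ) + 2) * ((n : ℝ) + 2 + a + b) * (2 * (n : ℝ) + 2 + a + b) *
      (1 / (2 * ((n : ℝ) + 2) * (((n : ℝ) + 2) + a + b) * (2 * ((n : ℝ) + 2) + a + b - 2))) = 1 := by
    rw [show 2 * ((n : ℝ) + 2) + a + b - 2 = 2 * (n : ℝ) + 2 + a + b by ring]
    refine mul_one_div_cancel (ne_of_gt ?_)
    have h1 : 0 < (n : ℝ) + 2 + a + b := by linarith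
    have h2 : 0 < 2 * (n : ℝ) + 2 + a + b := by linarith
    positivity
  rw [hK]
  simp only [map_add, map_sub, map_mul, map_one, map_pow, map_ofNat]
  ring

theorem jacobiP_natDegree_le {a b : ℝ} (n : ℕ) : (jacobiP a b n).natDegree ≤ n := by
  induction n using jacobiP.induct with
  | case1 => simp [jacobiP]
  | case2 => rw [jacobiP]; compute_degree
  | case3 n ih₁ ih₂ =>
    rw [jacobiP]
    refine (natDegree_C_mul_le _ _).trans ((natDegree_sub_le_of_le (m := n + 2) (n := n) ?_ ?_).trans ?_)
    · refine (natDegree_C_mul_le _ _).trans (natDegree_mul_le.trans ?_)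
      rw [add_comm n 2, show 2 + n = 1 + (n + 1) by omega]
      exact add_le_add (by compute_degree) ih₁
    · exact (natDegree_C_mul_le _ _).trans ih₂
    · simp

theorem jacobiP_coeff_self_ne_zero {a b : ℝ} (ha : -1 < a) (hb : -1 < b) (n : ℕ) :
    (jacobiP a b n).coeff n ≠ 0 := by
  induction n using jacobiP.induct with
  | case1 => simp [jacobiP]
  | case2 =>
    have : a + b + 2 ≠ 0 := by linarith
    simpa [jacobiP, coeff_C_succ] using this
  | case3 n ih₁ _ =>
    have hn : (0 : ℝ) ≤ n := n.cast_nonneg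
    intro h
    have h₁ : (jacobiP a b (n + 1)).coeff (n + 2) = 0 :=
      coeff_eq_zero_of_natDegree_lt ((jacobiP_natDegree_le _).trans_lt (by omega))
    have h₀ : (jacobiP a b n).coeff (n + 2) = 0 :=
      coeff_eq_zero_of_natDegree_lt ((jacobiP_natDegree_le _).trans_lt (by omega))
    have key := congrArg (coeff · (n + 2)) (jacobiP_recurrence ha hb n)
    rw [mul_assoc (C _) (_ + _), add_mul (C _ * X), mul_assoc (C _) X] at key
    simp only [coeff_sub, coeff_C_mul, coeff_add, coeff_X_mul, h, h₁, h₀,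
      mul_zero, add_zero, sub_zero] at key
    refine mul_ne_zero ?_ (mul_ne_zero (mul_ne_zero ?_ ?_) ih₁) key.symm <;> linarith

/-- The raising relation for `P_n` and the lowering relation for `P_{n+1}`. -/
theorem jacobiP_derivative_relations {a b : ℝ} (ha : -1 < a) (hb : -1 < b) (n : ℕ) :
    (C (2 * (n : ℝ) + 2 + a + b) * (1 - X ^ 2) * derivative (jacobiP a b n) =
      C ((n : ℝ) + 1 + a + b) * (C (a - b) + C (2 * (n : ℝ) + 2 + a + b) * X) * jacobiP a b n -
        C (2 * ((n : ℝ) + 1) * ((n : ℝ) + 1 + a + b)) * jacobiP a b (n + 1)) ∧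
    (C (2 * (n : ℝ) + 2 + a + b) * (1 - X ^ 2) * derivative (jacobiP a b (n + 1)) =
      C ((n : ℝ) + 1) * (C (a - b) - C (2 * (n : ℝ) + 2 + a + b) * X) * jacobiP a b (n + 1) +
        C (2 * ((n : ℝ) + 1 + a) * ((n : ℝ) + 1 + b)) * jacobiP a b n) := by
  induction n with
  | zero =>
    have h2 : (C 2 : ℝ[X]) * C (1 / 2) = 1 := by rw [← C_mul]; norm_num
    have h2' : (C 2 : ℝ[X]) = 2 := map_ofNat C 2
    constructor <;>
    · simp [jacobiP, div_eq_mul_inv] at h2 ⊢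
      grind
  | succ n ih =>
    obtain ⟨hR, hL⟩ := ih
    have hn : (0 : ℝ) ≤ n := n.cast_nonneg
    have hc : (C (2 * (n : ℝ) + 2 + a + b) : ℝ[X]) ≠ 0 := C_ne_zero.2 (by linarith)
    have hK : (C (2 * ((n : ℝ) + 2) * ((n : ℝ) + 2 + a + b)) : ℝ[X]) ≠ 0 :=
      C_ne_zero.2 (mul_ne_zero (by linarith) (by linarith))
    have hrec := jacobiP_recurrence ha hb n
    have drec := congrArg derivative hrec
    simp only [derivative_sub, derivative_mul, derivative_C, derivative_X, derivative_add] at drec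
    push_cast
    rw [show n + 1 + 1 = n + 2 from rfl]
    generalize jacobiP a b (n + 2) = p₂ at *
    generalize jacobiP a b (n + 1) = p₁ at *
    generalize jacobiP a b n = p₀ at *
    simp only [map_add, map_sub, map_mul, map_one, map_pow, map_ofNat] at *
    generalize (C (n : ℝ) : ℝ[X]) = m at *
    generalize (C a : ℝ[X]) = a at *
    generalize (C b : ℝ[X]) = b at *
    have hR' : (2 * (m + 1) + 2 + a + b) * (1 - X ^ 2) * derivative p₁ =
        (m + 1 + 1 + a + b) * (a - b + (2 * (m + 1) + 2 + a + b) * X) * p₁ -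
          2 * (m + 1 + 1) * (m + 1 + 1 + a + b) * p₂ := by
      refine mul_left_cancel₀ hc ?_
      linear_combination (2 * m + 4 + a + b) * hL + hrec
    refine ⟨hR', mul_left_cancel₀ (mul_ne_zero hK (mul_ne_zero hc hc)) ?_⟩
    linear_combination (2 * m + 2 + a + b) * (2 * m + 4 + a + b) * (1 - X ^ 2) * drec +
      (2 * m + 3 + a + b) * ((2 * m + 4 + a + b) * (2 * m + 2 + a + b) * X + (a ^ 2 - b ^ 2)) *
        (2 * m + 2 + a + b) * hR' -
      2 * (m + 1 + a) * (m + 1 + b) * (2 * m + 4 + a + b) ^ 2 * hR -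
      (2 * m + 4 + a + b) * (m + 1 + a + b) * (a - b + (2 * m + 2 + a + b) * X) * hrec

theorem jacobiP_ode {a b : ℝ} (ha : -1 < a) (hb : -1 < b) (n : ℕ) :
    (1 - X ^ 2) * derivative (derivative (jacobiP a b n)) +
        (C (b - a) - C (a + b + 2) * X) * derivative (jacobiP a b n) +
        C ((n : ℝ) * (n + a + b + 1)) * jacobiP a b n = 0 := by
  cases n with
  | zero => simp [jacobiP]
  | succ n =>
    obtain ⟨hR, hL⟩ := jacobiP_derivative_relations ha hb n
    have hn : (0 : ℝ) ≤ n := n.cast_nonneg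
    have hc : (C (2 * (n : ℝ) + 2 + a + b) : ℝ[X]) ≠ 0 := C_ne_zero.2 (by linarith)
    have hw : (1 - X ^ 2 : ℝ[X]) ≠ 0 := fun h => by simpa using congrArg (eval 0) h
    have dL := congrArg derivative hL
    simp only [derivative_sub, derivative_mul, derivative_C, derivative_X, derivative_add,
      derivative_one, derivative_X_sq] at dL
    push_cast
    generalize jacobiP a b (n + 1) = p₁ at *
    generalize jacobiP a b n = p₀ at *
    simp only [map_add, map_sub, map_mul, map_one, map_ofNat] at hR hL dL hc ⊢
    generalize (C (n : ℝ) : ℝ[X]) = m at *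
    generalize (C a : ℝ[X]) = a at *
    generalize (C b : ℝ[X]) = b at *
    refine mul_left_cancel₀ (mul_ne_zero (mul_ne_zero hc hc) hw) ?_
    linear_combination (2 * m + 2 + a + b) * (1 - X ^ 2) * dL +
      2 * (m + 1 + a) * (m + 1 + b) * hR -
      (m + 1 + a + b) * (a - b + (2 * m + 2 + a + b) * X) * hL

section ProductPolynomial

variable {ι : Type*} {s : Finset ι} {z : ι → ℝ} {x : ℝ}

theorem eval_derivative_prod_X_sub_C (hx : ∀ l ∈ s, x ≠ z l) :
    (derivative (∏ l ∈ s, (X - C (z l)))).eval x =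
      (∑ l ∈ s, 1 / (x - z l)) * (∏ l ∈ s, (X - C (z l))).eval x := by
  classical
  induction s using Finset.induction_on with
  | empty => simp
  | insert j s hj ih =>
    have hxj : x - z j ≠ 0 := sub_ne_zero.2 (hx j (Finset.mem_insert_self ..))
    have ih := ih fun l hl => hx l (Finset.mem_insert_of_mem hl)
    rw [Finset.prod_insert hj, Finset.sum_insert hj]
    simp only [derivative_mul, derivative_sub, derivative_X, derivative_C, eval_add, eval_mul, ih,
      eval_sub, eval_X, eval_C, eval_one, eval_zero]
    field_simp
    ring

theorem eval_derivative_derivative_prod_X_sub_C (hx : ∀ l ∈ s, x ≠ z l) :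
    (derivative (derivative (∏ l ∈ s, (X - C (z l))))).eval x =
      ((∑ l ∈ s, 1 / (x - z l)) ^ 2 - ∑ l ∈ s, 1 / (x - z l) ^ 2) *
        (∏ l ∈ s, (X - C (z l))).eval x := by
  classical
  induction s using Finset.induction_on with
  | empty => simp
  | insert j s hj ih =>
    have hxj : x - z j ≠ 0 := sub_ne_zero.2 (hx j (Finset.mem_insert_self ..))
    have hs : ∀ l ∈ s, x ≠ z l := fun l hl => hx l (Finset.mem_insert_of_mem hl)
    have ih := ih hs
    have h₁ := eval_derivative_prod_X_sub_C hs
    rw [Finset.prod_insert hj, Finset.sum_insert hj, Finset.sum_insert hj]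
    simp only [derivative_mul, derivative_sub, derivative_X, derivative_C, eval_add, eval_mul, ih,
      h₁, eval_sub, eval_X, eval_C, eval_one, eval_zero, derivative_add, derivative_one,
      derivative_zero]
    field_simp
    ring

end ProductPolynomial

section LinearFactor

variable {p q : ℝ[X]} {c : ℝ}

theorem derivative_X_sub_C_mul (h : p = (X - C c) * q) :
    derivative p = q + (X - C c) * derivative q := by
  simp [h, derivative_mul]

theorem derivative_derivative_X_sub_C_mul (h : p = (X - C c) * q) :
    derivative (derivative p) = 2 * derivative q + (X - C c) * derivative (derivative q) := by
  simp [derivative_X_sub_C_mul h, derivative_mul]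
  ring

theorem derivative_derivative_derivative_X_sub_C_mul (h : p = (X - C c) * q) :
    derivative (derivative (derivative p)) =
      3 * derivative (derivative q) + (X - C c) * derivative (derivative (derivative q)) := by
  simp [derivative_derivative_X_sub_C_mul h, derivative_mul]
  ring

end LinearFactor

theorem coeff_jacobi_operator (q : ℝ[X]) (a b κ : ℝ) (n : ℕ) :
    ((1 - X ^ 2) * derivative (derivative q) + (C (b - a) - C (a + b + 2) * X) * derivative q +
        C κ * q).coeff n =
      (n + 1) * (n + 2) * q.coeff (n + 2) + (b - a) * (n + 1) * q.coeff (n + 1) +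
        (κ - n * (n + a + b + 1)) * q.coeff n := by
  rw [sub_mul, sub_mul, one_mul, mul_assoc]
  simp only [coeff_add, coeff_sub, coeff_C_mul, coeff_derivative, X_pow_mul]
  rcases n with _ | _ | n
  · simp [coeff_derivative]
    ring
  · simp [coeff_derivative, coeff_mul_X_pow']
    ring
  · simp [coeff_derivative, coeff_mul_X_pow']
    ring

theorem jacobiP_eq_C_mul_prod {a b : ℝ} {N : ℕ} {z : Fin N → ℝ} (hz : Function.Injective z)
    (hroot : ∀ i, (jacobiP a b N).eval (z i) = 0) :
    jacobiP a b N = C ((jacobiP a b N).coeff N) * ∏ l, (X - C (z l)) := by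
  have hmonic : (∏ l, (X - C (z l))).Monic := monic_prod_of_monic _ _ fun l _ => monic_X_sub_C _
  have hdeg : (∏ l, (X - C (z l))).natDegree = N := by simp [natDegree_prod_of_monic, monic_X_sub_C]
  refine sub_eq_zero.1 (eq_zero_of_degree_lt_of_eval_index_eq_zero (s := Finset.univ)
    (v := z) hz.injOn ?_ fun i _ => ?_)
  · rw [Finset.card_univ, Fintype.card_fin, degree_lt_iff_coeff_zero]
    intro m hm
    rcases hm.eq_or_lt with rfl | hm
    · have := hmonic.coeff_natDegree
      rw [hdeg] at this
      simp [this]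
    · rw [coeff_sub, coeff_C_mul,
        coeff_eq_zero_of_natDegree_lt ((jacobiP_natDegree_le N).trans_lt hm),
        coeff_eq_zero_of_natDegree_lt (hdeg.trans_lt hm), mul_zero, sub_zero]
  · simp [hroot, eval_prod, Finset.prod_eq_zero (Finset.mem_univ i)]

theorem prod_jacobi_roots_ode {a b : ℝ} (ha : -1 < a) (hb : -1 < b) {N : ℕ} {z : Fin N → ℝ}
    (hz : Function.Injective z) (hroot : ∀ i, (jacobiP a b N).eval (z i) = 0) :
    (1 - X ^ 2) * derivative (derivative (∏ l, (X - C (z l)))) +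
        (C (b - a) - C (a + b + 2) * X) * derivative (∏ l, (X - C (z l))) +
        C ((N : ℝ) * (N + a + b + 1)) * ∏ l, (X - C (z l)) = 0 := by
  have hc : (C ((jacobiP a b N).coeff N) : ℝ[X]) ≠ 0 :=
    C_ne_zero.2 (jacobiP_coeff_self_ne_zero ha hb N)
  have h := jacobiP_ode ha hb N
  rw [jacobiP_eq_C_mul_prod hz hroot] at h
  refine mul_left_cancel₀ hc ?_
  simp only [derivative_C_mul] at h
  linear_combination h

/-- The action of the Jacobi differential operator on the polynomials `∏_{m ≠ l} (X - z m)`,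
read off at the roots `z i`. -/
theorem eval_jacobi_operator_prod_erase {a b κ : ℝ} {N : ℕ} {z : Fin N → ℝ}
    (hz : Function.Injective z) (hmem : ∀ i, z i ∈ Set.Ioo (-1 : ℝ) 1)
    (hode : (1 - X ^ 2) * derivative (derivative (∏ l, (X - C (z l)))) +
        (C (b - a) - C (a + b + 2) * X) * derivative (∏ l, (X - C (z l))) +
        C κ * ∏ l, (X - C (z l)) = 0) (i l : Fin N) :
    ((1 - X ^ 2) * derivative (derivative (∏ m ∈ Finset.univ.erase l, (X - C (z m)))) +
        (C (b - a) - C (a + b + 2) * X) *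
          derivative (∏ m ∈ Finset.univ.erase l, (X - C (z m))) +
        C κ * ∏ m ∈ Finset.univ.erase l, (X - C (z m))).eval (z i) =
      (∏ m ∈ Finset.univ.erase i, (X - C (z m))).eval (z i) *
        if l = i then
          2 * ∑ m ∈ Finset.univ.erase i, (1 - z i ^ 2) / (z i - z m) ^ 2 +
            (a + 1) * (1 + z i) / (1 - z i) + (b + 1) * (1 - z i) / (1 + z i)
        else -2 * (1 - z i ^ 2) / (z i - z l) ^ 2 := by
  have hfac (j : Fin N) :
      ∏ m, (X - C (z m)) = (X - C (z j)) * ∏ m ∈ Finset.univ.erase j, (X - C (z m)) :=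
    (Finset.mul_prod_erase _ _ (Finset.mem_univ j)).symm
  have hne : ∀ m ∈ Finset.univ.erase i, z i ≠ z m := fun m hm h =>
    Finset.ne_of_mem_erase hm (hz h.symm)
  obtain ⟨hl, hr⟩ := hmem i
  have h1 : 1 - z i ≠ 0 := by linarith
  have h2 : 1 + z i ≠ 0 := by linarith
  have hS := eval_derivative_prod_X_sub_C hne
  have hQ := eval_derivative_derivative_prod_X_sub_C hne
  have hW : (∏ m, (X - C (z m))).eval (z i) = 0 := by simp [hfac i]
  have hW1 := congrArg (eval (z i)) (derivative_X_sub_C_mul (hfac i))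
  have hW2 := congrArg (eval (z i)) (derivative_derivative_X_sub_C_mul (hfac i))
  have hW3 := congrArg (eval (z i)) (derivative_derivative_derivative_X_sub_C_mul (hfac i))
  have hode0 := congrArg (eval (z i)) hode
  have hode1 := congrArg (fun p => eval (z i) (derivative p)) hode
  simp only [derivative_sub, derivative_mul, derivative_C, derivative_X, derivative_add,
    derivative_one, derivative_X_sq, derivative_zero, eval_add, eval_sub, eval_mul, eval_C,
    eval_X, eval_pow, eval_one, eval_zero, eval_ofNat, eval_neg, hW, sub_self, zero_mul, add_zero,
    mul_zero, zero_add, zero_sub, mul_one] at hW1 hW2 hW3 hode0 hode1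
  have hP : (∏ m ∈ Finset.univ.erase i, (X - C (z m))).eval (z i) ≠ 0 := by
    rw [eval_prod, Finset.prod_ne_zero_iff]
    intro m hm
    simpa [sub_eq_zero] using hne m hm
  simp only [eval_add, eval_sub, eval_mul, eval_C, eval_X, eval_pow, eval_one]
  split_ifs with h
  · subst h
    simp only [mul_div_assoc, div_eq_mul_one_div (1 - z l ^ 2), ← Finset.mul_sum] at *
    rw [hQ, hS] at *
    rw [hW1, hW2] at hode0
    rw [hW1, hW2, hW3] at hode1
    generalize (∏ m ∈ Finset.univ.erase l, (X - C (z m))).eval (z l) = p at *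
    generalize ∑ m ∈ Finset.univ.erase l, 1 / (z l - z m) = S at *
    generalize ∑ m ∈ Finset.univ.erase l, 1 / (z l - z m) ^ 2 = Q at *
    have hw : 1 - z l ^ 2 ≠ 0 := by
      rw [show 1 - z l ^ 2 = (1 - z l) * (1 + z l) by ring]
      exact mul_ne_zero h1 h2
    have hode0 : 2 * (1 - z l ^ 2) * S + (b - a - (a + b + 2) * z l) = 0 :=
      mul_left_cancel₀ hP (by linear_combination hode0)
    have hode1 : 3 * (1 - z l ^ 2) * (S ^ 2 - Q) + 2 * (b - a - (a + b + 2) * z l - 2 * z l) * S -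
        (a + b + 2) + κ = 0 := mul_left_cancel₀ hP (by linear_combination hode1)
    have hdiag : 2 * z l * (b - a - (a + b + 2) * z l) / (1 - z l ^ 2) =
        a + b + 2 - (a + 1) * ((1 + z l) / (1 - z l)) - (b + 1) * ((1 - z l) / (1 + z l)) := by
      field_simp
      ring
    have hcancel : 2 * z l / (1 - z l ^ 2) * (2 * (1 - z l ^ 2) * S) = 4 * z l * S := by
      field_simp
      ring
    linear_combination p * (hode1 - S * hode0 + 2 * z l / (1 - z l ^ 2) * hode0 - hcancel - hdiag)
  · have hil : z i - z l ≠ 0 := sub_ne_zero.2 fun e => h (hz e).symm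
    have hV0 := congrArg (eval (z i)) (hfac l)
    have hV1 := congrArg (eval (z i)) (derivative_X_sub_C_mul (hfac l))
    have hV2 := congrArg (eval (z i)) (derivative_derivative_X_sub_C_mul (hfac l))
    simp only [eval_add, eval_sub, eval_mul, eval_C, eval_X, eval_ofNat, hW] at hV0 hV1 hV2
    have hV0 := (mul_eq_zero.1 hV0.symm).resolve_left hil
    rw [hV0, zero_add] at hV1
    rw [hV0]
    rw [hV1] at hW1
    rw [← mul_div_assoc, eq_div_iff (pow_ne_zero 2 hil)]
    linear_combination (z i - z l) * hode0 - (1 - z i ^ 2) * (z i - z l) * hV2 -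
      (b - a - (a + b + 2) * z i) * (z i - z l) * hV1 - 2 * (1 - z i ^ 2) * hW1

theorem jacobi_roots_eigenvalue {a b μ : ℝ} (ha : -1 < a) (hb : -1 < b) {N : ℕ} {z : Fin N → ℝ}
    (hz : Function.Injective z) (hmem : ∀ i, z i ∈ Set.Ioo (-1 : ℝ) 1)
    (hroot : ∀ i, (jacobiP a b N).eval (z i) = 0) {δ : Fin N → ℝ} (hδ : δ ≠ 0)
    (heig : ∀ i, ∑ l, (if l = i then
          2 * ∑ m ∈ Finset.univ.erase i, (1 - z i ^ 2) / (z i - z m) ^ 2 +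
            (a + 1) * (1 + z i) / (1 - z i) + (b + 1) * (1 - z i) / (1 + z i)
        else -2 * (1 - z i ^ 2) / (z i - z l) ^ 2) * δ l = μ * δ i) :
    ∃ j ∈ Set.Icc 1 N, μ = (j : ℝ) * (2 * (N : ℝ) + a + b + 1 - (j : ℝ)) := by
  have hode := prod_jacobi_roots_ode ha hb hz hroot
  set κ : ℝ := (N : ℝ) * (N + a + b + 1) with hκ
  set W : Fin N → ℝ[X] := fun l => ∏ m ∈ Finset.univ.erase l, (X - C (z m))
  set q : ℝ[X] := ∑ l, C (δ l) * W l with hq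
  have hWne (i : Fin N) : (W i).eval (z i) ≠ 0 := by
    rw [eval_prod, Finset.prod_ne_zero_iff]
    intro m hm
    simpa [sub_eq_zero] using fun h => Finset.ne_of_mem_erase hm (hz h).symm
  have hWdeg (l : Fin N) : (W l).natDegree < N := by
    have : (W l).natDegree = N - 1 := by
      simp [W, natDegree_prod_of_monic, monic_X_sub_C, Finset.card_erase_of_mem]
    have := l.pos
    omega
  have hqeval (i : Fin N) : q.eval (z i) = δ i * (W i).eval (z i) := by
    rw [hq, eval_finsetSum, Finset.sum_eq_single i]
    · simp
    · intro l _ hl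
      have : (W l).eval (z i) = 0 := by
        rw [eval_prod]
        exact Finset.prod_eq_zero (Finset.mem_erase.2 ⟨hl.symm, Finset.mem_univ i⟩) (by simp)
      simp [this]
    · simp
  have hq0 : q ≠ 0 := by
    intro h
    refine hδ (funext fun i => ?_)
    have := hqeval i
    rw [h, eval_zero] at this
    exact (mul_eq_zero.1 this.symm).resolve_right (hWne i)
  have hqcoeff (n : ℕ) (hn : N ≤ n) : q.coeff n = 0 := by
    rw [hq, finsetSum_coeff]
    refine Finset.sum_eq_zero fun l _ => ?_
    rw [coeff_C_mul, coeff_eq_zero_of_natDegree_lt ((hWdeg l).trans_le hn), mul_zero]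
  have hzero : (1 - X ^ 2) * derivative (derivative q) +
      (C (b - a) - C (a + b + 2) * X) * derivative q + C (κ - μ) * q = 0 := by
    refine eq_zero_of_degree_lt_of_eval_index_eq_zero (s := Finset.univ) (v := z) hz.injOn ?_
      fun i _ => ?_
    · rw [Finset.card_univ, Fintype.card_fin, degree_lt_iff_coeff_zero]
      intro n hn
      rw [coeff_jacobi_operator, hqcoeff n hn, hqcoeff (n + 1) (by omega),
        hqcoeff (n + 2) (by omega)]
      ring
    · have hlin : ((1 - X ^ 2) * derivative (derivative q) +
          (C (b - a) - C (a + b + 2) * X) * derivative q + C κ * q).eval (z i) =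
          ∑ l, δ l * ((1 - X ^ 2) * derivative (derivative (W l)) +
            (C (b - a) - C (a + b + 2) * X) * derivative (W l) + C κ * W l).eval (z i) := by
        simp only [hq, derivative_sum, derivative_C_mul, Finset.mul_sum, ← Finset.sum_add_distrib,
          eval_finsetSum]
        refine Finset.sum_congr rfl fun l _ => ?_
        simp only [eval_add, eval_mul, eval_C]
        ring
      have hsum : ∑ l, δ l * ((1 - X ^ 2) * derivative (derivative (W l)) +
            (C (b - a) - C (a + b + 2) * X) * derivative (W l) + C κ * W l).eval (z i) =
          (W i).eval (z i) * (μ * δ i) := by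
        rw [← heig i, Finset.mul_sum]
        refine Finset.sum_congr rfl fun l _ => ?_
        rw [eval_jacobi_operator_prod_erase hz hmem hode i l]
        ring
      rw [hsum] at hlin
      have hqi := hqeval i
      rw [map_sub C κ μ, sub_mul (C κ), ← add_sub_assoc, eval_sub, hlin, eval_mul, eval_C, hqi]
      ring
  have hdeg : q.natDegree < N := by
    by_contra! h
    exact hq0 (leadingCoeff_eq_zero.1 (hqcoeff _ h))
  have hlead := coeff_jacobi_operator q a b (κ - μ) q.natDegree
  rw [hzero, coeff_zero, coeff_eq_zero_of_natDegree_lt (n := q.natDegree + 2) (by omega),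
    coeff_eq_zero_of_natDegree_lt (n := q.natDegree + 1) (by omega), mul_zero, mul_zero, zero_add,
    zero_add] at hlead
  have hμ := (mul_eq_zero.1 hlead.symm).resolve_right (leadingCoeff_ne_zero.2 hq0)
  refine ⟨N - q.natDegree, ⟨by omega, by omega⟩, ?_⟩
  rw [Nat.cast_sub hdeg.le]
  linear_combination -hμ + hκ

theorem Matrix.IsHermitian.sum_sq_row_le {n : Type*} [Fintype n] [DecidableEq n]
    {A : Matrix n n ℝ} (hA : A.IsHermitian) {M : ℝ} (hM : ∀ k, |hA.eigenvalues k| ≤ M) (i : n) :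
    ∑ l, A i l ^ 2 ≤ M ^ 2 := by
  have hrow := hA.eigenvectorBasis.sum_sq_norm_inner_right (WithLp.toLp 2 (A i))
  have hunit := hA.eigenvectorBasis.sum_sq_norm_inner_right (EuclideanSpace.single i (1 : ℝ))
  have hinner (k : n) : inner ℝ (hA.eigenvectorBasis k) (WithLp.toLp 2 (A i)) =
      hA.eigenvalues k * hA.eigenvectorBasis k i := by
    have h := congrFun (hA.mulVec_eigenvectorBasis k) i
    simpa [PiLp.inner_apply, Matrix.mulVec, dotProduct] using h
  simp only [hinner] at hrow
  simp [EuclideanSpace.inner_single_right] at hunit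
  rw [EuclideanSpace.norm_sq_eq] at hrow
  simp only [Real.norm_eq_abs, sq_abs] at hrow
  rw [← hrow, ← mul_one (M ^ 2), ← hunit, Finset.mul_sum]
  refine Finset.sum_le_sum fun k _ => ?_
  rw [mul_pow]
  exact mul_le_mul_of_nonneg_right (sq_le_sq' (abs_le.1 (hM k)).1 (abs_le.1 (hM k)).2) (sq_nonneg _)

/-- For the ordered roots `-1 < z 0 < … < z (N-1) < 1` of the Jacobi
polynomial `P_N^{(α,β)}` (`α, β > -1`, `N ≥ 1`), with
`M = max_{j=1,…,N} 2j(2N+α+β+1-j)`, for every `i`,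
`(4·∑_{l ≠ i} (1-(z i)²)/(z i - z l)² + 2(α+1)(1+z i)/(1-z i) + 2(β+1)(1-z i)/(1+z i))²
  + 16·∑_{l ≠ i} (1-(z l)²)(1-(z i)²)/(z i - z l)⁴ ≤ M²`. -/
theorem jacobi_roots_inequality
    (α β : ℝ) (hα : -1 < α) (hβ : -1 < β) (N : ℕ) (hN : 1 ≤ N)
    (z : Fin N → ℝ) (hz : StrictMono z)
    (hmem : ∀ i, z i ∈ Set.Ioo (-1 : ℝ) 1)
    (hroot : ∀ i, (jacobiP α β N).eval (z i) = 0) (M : ℝ)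
    (hM : IsGreatest
      ((fun j : ℕ => 2 * (j : ℝ) * (2 * (N : ℝ) + α + β + 1 - (j : ℝ))) ''
        Set.Icc 1 N) M) (i : Fin N) :
    (4 * ∑ l ∈ Finset.univ.erase i, (1 - (z i) ^ 2) / (z i - z l) ^ 2
          + 2 * (α + 1) * (1 + z i) / (1 - z i)
          + 2 * (β + 1) * (1 - z i) / (1 + z i)) ^ 2
        + 16 * ∑ l ∈ Finset.univ.erase i,
            (1 - (z l) ^ 2) * (1 - (z i) ^ 2) / (z i - z l) ^ 4
      ≤ M ^ 2 := by
  classical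
  have hpos (i : Fin N) : 0 < 1 - z i ^ 2 := by
    obtain ⟨h₁, h₂⟩ := hmem i
    nlinarith
  set s : Fin N → ℝ := fun i => √(1 - z i ^ 2)
  have hs (i : Fin N) : s i ^ 2 = 1 - z i ^ 2 := Real.sq_sqrt (hpos i).le
  have hs0 (i : Fin N) : s i ≠ 0 := (Real.sqrt_pos.2 (hpos i)).ne'
  set T : Fin N → Fin N → ℝ := fun i l => if l = i then
      2 * ∑ m ∈ Finset.univ.erase i, (1 - z i ^ 2) / (z i - z m) ^ 2 +
        (α + 1) * (1 + z i) / (1 - z i) + (β + 1) * (1 - z i) / (1 + z i)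
    else -2 * (1 - z i ^ 2) / (z i - z l) ^ 2
  set A : Matrix (Fin N) (Fin N) ℝ := Matrix.of fun i l => if l = i then 2 * T i i
    else -4 * s i * s l / (z i - z l) ^ 2
  have hA : A.IsHermitian := by
    ext i l
    by_cases h : i = l
    · simp [h]
    · simp [A, h, Ne.symm h, sub_sq_comm (z i)]
      ring
  have hAT (i l : Fin N) : s i * A i l = 2 * T i l * s l := by
    by_cases h : l = i
    · subst h
      simp [A, mul_comm]
    · simp only [A, T, h, Matrix.of_apply, if_false, ← hs]
      ring
  have heigen (k : Fin N) : |hA.eigenvalues k| ≤ M := by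
    have hδ : (fun l => s l * hA.eigenvectorBasis k l) ≠ 0 := by
      intro h
      refine hA.eigenvectorBasis.toBasis.ne_zero k ?_
      ext l
      simpa [hs0] using congrFun h l
    obtain ⟨j, hj, hμ⟩ := jacobi_roots_eigenvalue (μ := hA.eigenvalues k / 2) hα hβ hz.injective
      hmem hroot hδ fun i => by
        have h := congrFun (hA.mulVec_eigenvectorBasis k) i
        simp only [Matrix.mulVec, dotProduct, Pi.smul_apply, smul_eq_mul] at h
        have h2 : ∑ l, 2 * (T i l * (s l * hA.eigenvectorBasis k l)) =
            s i * (hA.eigenvalues k * hA.eigenvectorBasis k i) := by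
          rw [← h, Finset.mul_sum]
          refine Finset.sum_congr rfl fun l _ => ?_
          linear_combination -hA.eigenvectorBasis k l * hAT i l
        rw [← Finset.mul_sum] at h2
        linear_combination h2 / 2
    have hjN : (j : ℝ) ≤ N := by exact_mod_cast hj.2
    have hN' : (1 : ℝ) ≤ N := by exact_mod_cast hN
    have hle := hM.2 ⟨j, hj, rfl⟩
    have hnn : 0 ≤ (j : ℝ) * (2 * (N : ℝ) + α + β + 1 - (j : ℝ)) :=
      mul_nonneg j.cast_nonneg (by linarith)
    simp only at hle
    rw [abs_le]
    constructor <;> linarith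
  have hrow := hA.sum_sq_row_le heigen i
  rw [← Finset.add_sum_erase _ _ (Finset.mem_univ i)] at hrow
  refine le_of_eq_of_le ?_ hrow
  congr 1
  · simp only [A, T, Matrix.of_apply, if_true]
    ring
  · rw [Finset.mul_sum]
    refine Finset.sum_congr rfl fun l hl => ?_
    simp only [A, Matrix.of_apply, if_neg (Finset.ne_of_mem_erase hl), ← hs, div_pow,
      ← pow_mul]
    ring
end

section
/- Let α, β > −1, N ≥ 1, let −1 < z_{1,N} < ... < z_{N,N} < 1 be the ordered roots of the Jacobi polynomial P_N^{(α,β)}, and let M = max_{j=1,...,N} 2j(2N + α + β + 1 − j). Then for every i ∈ {1,...,N}, 1 − z_{i,N}² ≥ 2·min(α+1, β+1)/M. Moreover, if α = β, then for every i, 1 − z_{i,N}² ≥ 8(α+1)/(M + 4(α+1)). -/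
open Polynomial in
/-- Differentiating a real polynomial which splits over `ℝ` gives one which splits. -/
theorem splits_derivative_of_splits_real {f : ℝ[X]} (hf : f.Splits) :
    (derivative f).Splits := by
  rcases Nat.eq_zero_or_pos f.natDegree with h0 | h0
  · rw [eq_C_of_natDegree_eq_zero h0, derivative_C]
    exact Splits.zero
  · rw [splits_iff_card_roots] at hf ⊢
    have h₁ := card_roots_le_derivative f
    have h₂ := card_roots' (derivative f)
    have h₃ := natDegree_derivative_lt h0.ne'
    omega

open Polynomial in
/-- Laguerre's inequality for real-rooted polynomials. -/
theorem eval_mul_eval_derivative_derivative_le_sq {f : ℝ[X]} (hf : f.Splits) (x : ℝ) :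
    f.eval x * (derivative (derivative f)).eval x ≤ (derivative f).eval x ^ 2 := by
  obtain ⟨m, hm⟩ := splits_iff_exists_multiset.1 hf
  rw [hm]
  clear hm
  induction m using Multiset.induction_on with
  | empty => simp
  | cons a m ih =>
    rw [Multiset.map_cons, Multiset.prod_cons, mul_left_comm]
    set g := C f.leadingCoeff * (m.map fun a ↦ X - C a).prod
    simp only [derivative_mul, derivative_sub, derivative_X, derivative_C, derivative_add,
      eval_add, eval_mul, eval_sub, eval_X, eval_C, sub_zero, one_mul]
    nlinarith [sq_nonneg (g.eval x), mul_le_mul_of_nonneg_left ih (sq_nonneg (x - a))]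

open Polynomial in
theorem splits_and_derivative_ne_zero_of_injective_roots {N : ℕ} {f : ℝ[X]} (hf : f ≠ 0)
    (hdeg : f.natDegree ≤ N) {z : Fin N → ℝ} (hz : Function.Injective z)
    (hroot : ∀ i, f.eval (z i) = 0) :
    f.Splits ∧ ∀ i, (derivative f).eval (z i) ≠ 0 := by
  have hsub : Finset.univ.image z ⊆ f.roots.toFinset := by
    intro x hx
    obtain ⟨i, -, rfl⟩ := Finset.mem_image.1 hx
    simpa [hf] using hroot i
  have h₁ := Finset.card_le_card hsub
  rw [Finset.card_image_of_injective _ hz, Finset.card_univ, Fintype.card_fin] at h₁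
  have h₂ := Multiset.toFinset_card_le f.roots
  have h₃ := card_roots' f
  refine ⟨splits_iff_card_roots.2 (by omega), fun i hi ↦ ?_⟩
  have hnodup : f.roots.Nodup := Multiset.toFinset_card_eq_card_iff_nodup.1 (by omega)
  have hmult := Multiset.nodup_iff_count_le_one.1 hnodup (z i)
  rw [count_roots] at hmult
  exact hmult.not_gt ((one_lt_rootMultiplicity_iff_isRoot hf).2 ⟨hroot i, hi⟩)

section Jacobi

variable {a b : ℝ}

open Polynomial in
theorem jacobiP_natDegree_le_and_coeff_pos (ha : -1 < a) (hb : -1 < b) (n : ℕ) :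
    (jacobiP a b n).natDegree ≤ n ∧ 0 < (jacobiP a b n).coeff n := by
  induction n using Nat.twoStepInduction with
  | zero => simp [jacobiP]
  | one =>
    rw [jacobiP]
    refine ⟨by compute_degree, ?_⟩
    simp only [coeff_add, coeff_C_mul, coeff_X_one, coeff_C_succ]
    linarith
  | more n h₀ h₁ =>
    have hn : (0 : ℝ) ≤ n := n.cast_nonneg
    have hA : (0 : ℝ) < 1 / (2 * ((n : ℝ) + 2) * (((n : ℝ) + 2) + a + b)
        * (2 * ((n : ℝ) + 2) + a + b - 2)) := by
      have h1 : (0 : ℝ) < (n : ℝ) + 2 + a + b := by linarith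
      have h2 : (0 : ℝ) < 2 * ((n : ℝ) + 2) + a + b - 2 := by linarith
      positivity
    have hB : (0 : ℝ) < 2 * ((n : ℝ) + 2) + a + b - 1 := by linarith
    have hC : (0 : ℝ) < (2 * ((n : ℝ) + 2) + a + b) * (2 * ((n : ℝ) + 2) + a + b - 2) :=
      mul_pos (by linarith) (by linarith)
    rw [jacobiP]
    generalize (2 * (((n : ℝ) + 2) + a - 1) * (((n : ℝ) + 2) + b - 1)
              * (2 * ((n : ℝ) + 2) + a + b)) = D
    generalize a ^ 2 - b ^ 2 = E
    generalize (1 : ℝ) / _ = A at hA ⊢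
    generalize (2 * ((n : ℝ) + 2) + a + b) * _ = K at hC ⊢
    generalize 2 * ((n : ℝ) + 2) + a + b - 1 = B at hB ⊢
    obtain ⟨h₀, -⟩ := h₀
    obtain ⟨h₁, hpos⟩ := h₁
    constructor
    · refine (natDegree_C_mul_le _ _).trans ((natDegree_sub_le _ _).trans (max_le ?_ ?_))
      · refine (natDegree_C_mul_le _ _).trans (natDegree_mul_le.trans ?_)
        have : (C K * X + C E).natDegree ≤ 1 := by compute_degree
        omega
      · exact (natDegree_C_mul_le _ _).trans (by omega)
    · have e₁ : (jacobiP a b (n + 1)).coeff (n + 2) = 0 :=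
        coeff_eq_zero_of_natDegree_lt (by omega)
      have e₂ : (jacobiP a b n).coeff (n + 2) = 0 :=
        coeff_eq_zero_of_natDegree_lt (by omega)
      simp only [coeff_C_mul, coeff_sub, add_mul, mul_assoc, coeff_add, e₁, e₂,
        coeff_X_mul, mul_zero, add_zero, sub_zero]
      positivity

open Polynomial in
theorem jacobiP_eval_recurrence (ha : -1 < a) (hb : -1 < b) (n : ℕ) (x : ℝ) :
    2 * ((n : ℝ) + 2) * (n + 2 + a + b) * (2 * (n + 1) + a + b) * (jacobiP a b (n + 2)).eval x
      = (2 * (n + 1) + a + b + 1) * ((2 * (n + 1) + a + b + 2) * (2 * (n + 1) + a + b) * x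
          + (a ^ 2 - b ^ 2)) * (jacobiP a b (n + 1)).eval x
        - 2 * (n + 1 + a) * (n + 1 + b) * (2 * (n + 1) + a + b + 2) * (jacobiP a b n).eval x := by
  have hn : (0 : ℝ) ≤ n := n.cast_nonneg
  have h0 : (n : ℝ) + 2 ≠ 0 := by linarith
  have h1 : (n : ℝ) + 2 + a + b ≠ 0 := by linarith
  have h2 : 2 * ((n : ℝ) + 2) + a + b - 2 ≠ 0 := by linarith
  rw [jacobiP]
  simp only [eval_mul, eval_add, eval_sub, eval_C, eval_X]
  field_simp
  ring

open Polynomial in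
theorem jacobiP_eval_derivative_recurrence (ha : -1 < a) (hb : -1 < b) (n : ℕ) (x : ℝ) :
    2 * ((n : ℝ) + 2) * (n + 2 + a + b) * (2 * (n + 1) + a + b)
        * (derivative (jacobiP a b (n + 2))).eval x
      = (2 * (n + 1) + a + b + 1) * ((2 * (n + 1) + a + b + 2) * (2 * (n + 1) + a + b) * x
          + (a ^ 2 - b ^ 2)) * (derivative (jacobiP a b (n + 1))).eval x
        + (2 * (n + 1) + a + b + 1) * ((2 * (n + 1) + a + b + 2) * (2 * (n + 1) + a + b))
          * (jacobiP a b (n + 1)).eval x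
        - 2 * (n + 1 + a) * (n + 1 + b) * (2 * (n + 1) + a + b + 2)
          * (derivative (jacobiP a b n)).eval x := by
  have hn : (0 : ℝ) ≤ n := n.cast_nonneg
  have h0 : (n : ℝ) + 2 ≠ 0 := by linarith
  have h1 : (n : ℝ) + 2 + a + b ≠ 0 := by linarith
  have h2 : 2 * ((n : ℝ) + 2) + a + b - 2 ≠ 0 := by linarith
  rw [jacobiP]
  simp only [derivative_mul, derivative_add, derivative_sub, derivative_C, derivative_X,
    eval_mul, eval_add, eval_sub, eval_C, eval_X, eval_zero, eval_one]
  field_simp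
  ring

open Polynomial in
/-- The structure relations expressing `(1 - x²) P_{n+1}'` and `(1 - x²) P_n'` through `P_{n+1}`
and `P_n`. -/
theorem jacobiP_structure_relations (ha : -1 < a) (hb : -1 < b) (n : ℕ) (x : ℝ) :
    ((2 * ((n : ℝ) + 1) + a + b) * (1 - x ^ 2) * (derivative (jacobiP a b (n + 1))).eval x
      = (n + 1) * (a - b - (2 * (n + 1) + a + b) * x) * (jacobiP a b (n + 1)).eval x
        + 2 * (n + 1 + a) * (n + 1 + b) * (jacobiP a b n).eval x) ∧
    ((2 * ((n : ℝ) + 1) + a + b) * (1 - x ^ 2) * (derivative (jacobiP a b n)).eval x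
      = (n + 1 + a + b) * (a - b + (2 * (n + 1) + a + b) * x) * (jacobiP a b n).eval x
        - 2 * (n + 1) * (n + 1 + a + b) * (jacobiP a b (n + 1)).eval x) := by
  induction n with
  | zero =>
    simp only [jacobiP, derivative_mul, derivative_add, derivative_C, derivative_X, derivative_one,
      eval_mul, eval_add, eval_C, eval_X, eval_zero, eval_one, Nat.cast_zero]
    constructor <;> ring
  | succ n ih =>
    obtain ⟨h₁, h₂⟩ := ih
    have hn : (0 : ℝ) ≤ n := n.cast_nonneg
    have hr := jacobiP_eval_recurrence ha hb n x
    have hd := jacobiP_eval_derivative_recurrence ha hb n x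
    have hc : 2 * ((n : ℝ) + 1) + a + b ≠ 0 := by linarith
    have hK : 2 * ((n : ℝ) + 2) * (n + 2 + a + b) * (2 * (n + 1) + a + b) ≠ 0 :=
      mul_ne_zero (mul_ne_zero (by linarith) (by linarith)) hc
    push_cast
    constructor
    · refine mul_left_cancel₀ (mul_ne_zero hK hc) ?_
      linear_combination
        (2 * ((n : ℝ) + 1) + a + b + 2) * (2 * (n + 1) + a + b) * (1 - x ^ 2) * hd
        + (2 * ((n : ℝ) + 1) + a + b + 2) * (2 * (n + 1) + a + b + 1)
          * ((2 * (n + 1) + a + b + 2) * (2 * (n + 1) + a + b) * x + (a ^ 2 - b ^ 2)) * h₁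
        - (2 * ((n : ℝ) + 1) + a + b + 2) * (2 * (n + 1 + a) * (n + 1 + b)
          * (2 * (n + 1) + a + b + 2)) * h₂
        - ((n : ℝ) + 2) * (a - b - (2 * (n + 1) + a + b + 2) * x) * (2 * (n + 1) + a + b) * hr
    · refine mul_left_cancel₀ hc ?_
      linear_combination (2 * ((n : ℝ) + 1) + a + b + 2) * h₁ + hr

open Polynomial in
/-- The Jacobi differential equation. -/
theorem jacobiP_differential_equation (ha : -1 < a) (hb : -1 < b) (n : ℕ) :
    (1 - X ^ 2) * derivative (derivative (jacobiP a b (n + 1)))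
      + (C (b - a) - C (a + b + 2) * X) * derivative (jacobiP a b (n + 1))
      + C (((n : ℝ) + 1) * (n + 1 + a + b + 1)) * jacobiP a b (n + 1) = 0 := by
  have hn : (0 : ℝ) ≤ n := n.cast_nonneg
  have hc : 2 * ((n : ℝ) + 1) + a + b ≠ 0 := by linarith
  have hX : (1 - X ^ 2 : ℝ[X]) ≠ 0 := by
    intro h
    simpa using congrArg (eval 0) h
  refine (mul_eq_zero.1 ?_).resolve_left hX
  have hD : C (2 * ((n : ℝ) + 1) + a + b) * (1 - X ^ 2) * derivative (jacobiP a b (n + 1))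
      = C ((n : ℝ) + 1) * (C (a - b) - C (2 * ((n : ℝ) + 1) + a + b) * X) * jacobiP a b (n + 1)
        + C (2 * (n + 1 + a) * (n + 1 + b)) * jacobiP a b n :=
    Polynomial.funext fun x ↦ by
      simpa using (jacobiP_structure_relations ha hb n x).1
  have hD' := congrArg derivative hD
  refine Polynomial.funext fun x ↦ ?_
  obtain ⟨h₁, h₂⟩ := jacobiP_structure_relations ha hb n x
  replace hD' := congrArg (eval x) hD'
  simp only [derivative_mul, derivative_add, derivative_sub, derivative_C, derivative_X,
    derivative_X_pow, derivative_one, eval_mul, eval_add, eval_sub, eval_C, eval_X, eval_zero,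
    eval_one, eval_pow, Nat.cast_ofNat] at hD' ⊢
  refine mul_left_cancel₀ (mul_ne_zero hc hc) ?_
  linear_combination (2 * ((n : ℝ) + 1) + a + b) * (1 - x ^ 2) * hD'
    + 2 * ((n : ℝ) + 1 + a) * (n + 1 + b) * h₂
    - ((n : ℝ) + 1 + a + b) * (a - b + (2 * (n + 1) + a + b) * x) * h₁

open Polynomial in
theorem jacobiP_root_inequality (ha : -1 < a) (hb : -1 < b) (n : ℕ)
    {z : Fin (n + 1) → ℝ} (hz : Function.Injective z)
    (hroot : ∀ i, (jacobiP a b (n + 1)).eval (z i) = 0) (i : Fin (n + 1)) :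
    2 * z i * (a - b + (a + b + 2) * z i) ≤
      (1 - z i ^ 2) * (((n : ℝ) + 1) * (n + 1 + a + b + 1) - (a + b + 2)) := by
  obtain ⟨hdeg, hcoeff⟩ := jacobiP_natDegree_le_and_coeff_pos ha hb (n + 1)
  have hP : jacobiP a b (n + 1) ≠ 0 := by
    rintro h
    simp [h] at hcoeff
  obtain ⟨hs, hne⟩ := splits_and_derivative_ne_zero_of_injective_roots hP hdeg hz hroot
  have hlag := eval_mul_eval_derivative_derivative_le_sq (splits_derivative_of_splits_real hs) (z i)
  have hode := jacobiP_differential_equation ha hb n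
  have h₁ := congrArg (eval (z i)) hode
  have h₂ := congrArg (fun p ↦ eval (z i) (derivative p)) hode
  simp only [derivative_mul, derivative_add, derivative_sub, derivative_C, derivative_X,
    derivative_X_pow, derivative_one, derivative_zero, eval_mul, eval_add, eval_sub, eval_C, eval_X,
    eval_zero, eval_one, eval_pow, Nat.cast_ofNat, hroot i] at h₁ h₂
  have hp : 0 < (derivative (jacobiP a b (n + 1))).eval (z i) ^ 2 := by
    have := hne i
    positivity
  generalize z i = x at *
  generalize (derivative (jacobiP a b (n + 1))).eval x = p at *
  generalize (derivative (derivative (jacobiP a b (n + 1)))).eval x = q at *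
  generalize (derivative (derivative (derivative (jacobiP a b (n + 1))))).eval x = r at *
  have hq : (1 - x ^ 2) * q = (a - b + (a + b + 2) * x) * p := by linear_combination h₁
  have hr : (1 - x ^ 2) * r = (a - b + (a + b + 4) * x) * q
      - (((n : ℝ) + 1) * (n + 1 + a + b + 1) - (a + b + 2)) * p := by linear_combination h₂
  have hw := mul_le_mul_of_nonneg_left hlag (sq_nonneg (1 - x ^ 2))
  have e₁ : (1 - x ^ 2) ^ 2 * q ^ 2 = (a - b + (a + b + 2) * x) ^ 2 * p ^ 2 := by
    rw [← mul_pow, hq, mul_pow]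
  have e₂ : (1 - x ^ 2) ^ 2 * (p * r)
      = ((a - b + (a + b + 4) * x) * (a - b + (a + b + 2) * x)
        - (1 - x ^ 2) * (((n : ℝ) + 1) * (n + 1 + a + b + 1) - (a + b + 2))) * p ^ 2 := by
    linear_combination (1 - x ^ 2) * p * hr + (a - b + (a + b + 4) * x) * p * hq
  rw [e₁, e₂] at hw
  have := le_of_mul_le_mul_right hw hp
  linarith

end Jacobi

theorem min_le_mul_of_mul_le {A B l x : ℝ} (hA : 0 < A) (hB : 0 < B) (hl : A + B ≤ l)
    (hx : x ∈ Set.Ioo (-1 : ℝ) 1)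
    (h : 2 * x * (A - B + (A + B) * x) ≤ (1 - x ^ 2) * (l - (A + B))) :
    min A B ≤ l * (1 - x ^ 2) := by
  wlog hx0 : 0 ≤ x generalizing A B x
  · have := this hB hA (by linarith) (x := -x) ⟨by linarith [hx.2], by linarith [hx.1]⟩
      (by linarith) (by linarith)
    rwa [min_comm, neg_sq] at this
  by_contra! hlt
  have hmA : min A B ≤ A := min_le_left _ _
  have hmB : min A B ≤ B := min_le_right _ _
  have hw : 0 < 1 - x ^ 2 := by nlinarith [hx.1, hx.2]
  have hs : (A + B) * (1 - x ^ 2) < min A B :=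
    (mul_le_mul_of_nonneg_right hl hw.le).trans_lt hlt
  have ht : (A + B) * (1 - x) ≤ (A + B) * (1 - x ^ 2) :=
    mul_le_mul_of_nonneg_left (by nlinarith [hx.2]) (by linarith)
  have hL : A ≤ A - B + (A + B) * x := by linarith
  have hx2 : 1 / 2 ≤ x := by
    by_contra! hc
    nlinarith
  nlinarith

/-- For the ordered roots `-1 < z 0 < … < z (N-1) < 1` of the Jacobi
polynomial `P_N^{(α,β)}` (`α, β > -1`, `N ≥ 1`), with
`M = max_{j=1,…,N} 2j(2N+α+β+1-j)`, every root satisfies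
`1 - (z i)² ≥ 2·min(α+1, β+1)/M`; moreover, if `α = β`, then
`1 - (z i)² ≥ 8(α+1)/(M + 4(α+1))`. -/
theorem jacobi_roots_distance_from_boundary
    (α β : ℝ) (hα : -1 < α) (hβ : -1 < β) (N : ℕ) (hN : 1 ≤ N)
    (z : Fin N → ℝ) (hz : StrictMono z)
    (hmem : ∀ i, z i ∈ Set.Ioo (-1 : ℝ) 1)
    (hroot : ∀ i, (jacobiP α β N).eval (z i) = 0) (M : ℝ)
    (hM : IsGreatest
      ((fun j : ℕ => 2 * (j : ℝ) * (2 * (N : ℝ) + α + β + 1 - (j : ℝ))) ''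
        Set.Icc 1 N) M) :
    (∀ i, 1 - (z i) ^ 2 ≥ 2 * min (α + 1) (β + 1) / M)
      ∧ (α = β → ∀ i, 1 - (z i) ^ 2 ≥ 8 * (α + 1) / (M + 4 * (α + 1))) := by
  obtain ⟨n, rfl⟩ : ∃ n, N = n + 1 := ⟨N - 1, by omega⟩
  have hMl := hM.2 ⟨n + 1, ⟨hN, le_rfl⟩, rfl⟩
  push_cast at hMl
  have hn : (0 : ℝ) ≤ n := n.cast_nonneg
  have hl : α + 1 + (β + 1) ≤ ((n : ℝ) + 1) * (n + 1 + α + β + 1) := by nlinarith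
  have hM0 : 0 < M := by nlinarith
  have hkey := jacobiP_root_inequality hα hβ n hz.injective hroot
  have hw : ∀ i, 0 < 1 - z i ^ 2 := fun i ↦ by nlinarith [(hmem i).1, (hmem i).2]
  have hMw : ∀ i, 2 * (((n : ℝ) + 1) * (n + 1 + α + β + 1)) * (1 - z i ^ 2)
      ≤ M * (1 - z i ^ 2) :=
    fun i ↦ mul_le_mul_of_nonneg_right (by linarith) (hw i).le
  refine ⟨fun i ↦ ?_, ?_⟩
  · rw [ge_iff_le, div_le_iff₀ hM0]
    have := min_le_mul_of_mul_le (by linarith) (by linarith) hl (hmem i)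
      (by linarith [hkey i])
    linarith [hMw i]
  · rintro rfl i
    rw [ge_iff_le, div_le_iff₀ (by linarith)]
    linarith [hkey i, hMw i]
end
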